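/- (Conformal null case, description of F(Z).) Let Z ∈ (ℝⁿ)* be a nonzero row covector with ⟨Z,Z⟩ = 0. A column vector X ∈ ℝⁿ satisfies ⁅ι₋(X), ⁅ι₋(X), ι₊(Z)⁆⁆ = 0 if and only if Z⬝X = 0 and ⟨X,X⟩ = 0. -/

import Mathlib

open Matrix

/-- Index type for (n+2)×(n+2) block matrices with blocks of sizes 1, n, 1. -/
abbrev Idx (n : ℕ) := Unit ⊕ Fin n ⊕ Unit

/-- The diagonal entries of the signature matrix I = diag(Id_p, −Id_q). -/
def sig (p q : ℕ) : Fin (p + q) → ℝ := fun i => if (i : ℕ) < p then 1 else -1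

/-- The n×n signature matrix I = diag(Id_p, −Id_q). -/
def sigMat (p q : ℕ) : Matrix (Fin (p + q)) (Fin (p + q)) ℝ := Matrix.diagonal (sig p q)

/-- The inner product of signature (p,q): ⟨X,Y⟩ = Xᵀ I Y (the same formula gives
Z I Wᵀ for row covectors). -/
def form (p q : ℕ) (X Y : Fin (p + q) → ℝ) : ℝ := ∑ i, X i * sig p q i * Y i

/-- The column vector I Zᵀ associated to a row covector Z (written `starr`) (equally, the row covector
Xᵀ I associated to a column vector X). -/
def iFlip (p q : ℕ) (Z : Fin (p + q) → ℝ) : Fin (p + q) → ℝ := fun i => sig p q i * Z i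

/-- Embedding of g₋₁ ≅ ℝⁿ into so(p+1,q+1): (2,1)-block X, (3,2)-block −XᵀI. -/
def iotaMinus (p q : ℕ) (X : Fin (p + q) → ℝ) : Matrix (Idx (p + q)) (Idx (p + q)) ℝ :=
  Matrix.of fun i j =>
    match i, j with
    | Sum.inr (Sum.inl i), Sum.inl _ => X i
    | Sum.inr (Sum.inr _), Sum.inr (Sum.inl j) => -(X j * sig p q j)
    | _, _ => 0

/-- Embedding of g₁ ≅ (ℝⁿ)* into so(p+1,q+1): (1,2)-block Z, (2,3)-block −IZᵀ. -/
def iotaPlus (p q : ℕ) (Z : Fin (p + q) → ℝ) : Matrix (Idx (p + q)) (Idx (p + q)) ℝ :=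
  Matrix.of fun i j =>
    match i, j with
    | Sum.inl _, Sum.inr (Sum.inl j) => Z j
    | Sum.inr (Sum.inl i), Sum.inr (Sum.inr _) => -(sig p q i * Z i)
    | _, _ => 0

/-- Embedding of g₀ into so(p+1,q+1): block diagonal matrix diag(a, A, −a). -/
def iotaZero (p q : ℕ) (A : Matrix (Fin (p + q)) (Fin (p + q)) ℝ) (a : ℝ) :
    Matrix (Idx (p + q)) (Idx (p + q)) ℝ :=
  Matrix.of fun i j =>
    match i, j with
    | Sum.inl _, Sum.inl _ => a
    | Sum.inr (Sum.inl i), Sum.inr (Sum.inl j) => A i j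
    | Sum.inr (Sum.inr _), Sum.inr (Sum.inr _) => -a
    | _, _ => 0

theorem sig_mul_self (p q : ℕ) (i : Fin (p + q)) : sig p q i * sig p q i = 1 := by
  unfold sig
  split_ifs <;> norm_num

theorem iotaMinus_eq_zero_iff (p q : ℕ) (X : Fin (p + q) → ℝ) :
    iotaMinus p q X = 0 ↔ X = 0 := by
  constructor
  · intro h
    funext i
    simpa [iotaMinus] using congrFun (congrFun h (Sum.inr (Sum.inl i))) (Sum.inl ())
  · rintro rfl
    ext (i | i | i) (j | j | j) <;> simp [iotaMinus]

theorem lie_iotaMinus_iotaPlus (p q : ℕ) (X Z : Fin (p + q) → ℝ) :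
    ⁅iotaMinus p q X, iotaPlus p q Z⁆ =
      iotaZero p q (vecMulVec X Z - vecMulVec (iFlip p q Z) (iFlip p q X)) (-∑ i, Z i * X i) := by
  have hsum : ∑ i, X i * sig p q i * (sig p q i * Z i) = ∑ i, Z i * X i :=
    Finset.sum_congr rfl fun i _ => by linear_combination Z i * X i * sig_mul_self p q i
  ext (i | i | i) (j | j | j) <;>
    simp [Ring.lie_def, Matrix.mul_apply, iotaMinus, iotaPlus, iotaZero, vecMulVec_apply, iFlip,
      hsum]
  exact Or.inl (mul_comm _ _)

theorem lie_iotaMinus_iotaZero (p q : ℕ) (X : Fin (p + q) → ℝ)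
    (A : Matrix (Fin (p + q)) (Fin (p + q)) ℝ) (a : ℝ)
    (hA : (iFlip p q X) ᵥ* A = -iFlip p q (A *ᵥ X)) :
    ⁅iotaMinus p q X, iotaZero p q A a⁆ = iotaMinus p q (a • X - A *ᵥ X) := by
  have hA' (j : Fin (p + q)) : ∑ i, X i * sig p q i * A i j = -(sig p q j * (A *ᵥ X) j) := by
    simpa [vecMul, dotProduct, iFlip, mul_comm] using congrFun hA j
  ext (i | i | i) (j | j | j) <;>
    simp [Ring.lie_def, Matrix.mul_apply, iotaMinus, iotaZero, hA', mulVec, dotProduct] <;> ring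

/-- The double bracket `⁅X, ⁅X, Z⁆⁆` is the element `⟨X,X⟩ I Zᵀ − 2 (Z⬝X) X` of `g₋₁`. -/
theorem lie_iotaMinus_lie_iotaMinus_iotaPlus (p q : ℕ) (X Z : Fin (p + q) → ℝ) :
    ⁅iotaMinus p q X, ⁅iotaMinus p q X, iotaPlus p q Z⁆⁆ =
      iotaMinus p q (form p q X X • iFlip p q Z - (2 * ∑ i, Z i * X i) • X) := by
  have hXX : iFlip p q X ⬝ᵥ X = form p q X X :=
    Finset.sum_congr rfl fun i _ => by simp only [iFlip]; ring
  have hZX : Z ⬝ᵥ X = ∑ i, Z i * X i := rfl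
  have hXZ : iFlip p q X ⬝ᵥ iFlip p q Z = ∑ i, Z i * X i :=
    Finset.sum_congr rfl fun i _ => by
      simp only [iFlip]
      linear_combination Z i * X i * sig_mul_self p q i
  rw [lie_iotaMinus_iotaPlus, lie_iotaMinus_iotaZero]
  · congr 1
    funext i
    simp [sub_mulVec, vecMulVec_mulVec, hXX, hZX]
    ring
  · funext i
    simp [vecMul_sub, sub_mulVec, vecMul_vecMulVec, vecMulVec_mulVec, hXX, hXZ, hZX, iFlip]
    linear_combination (-form p q X X * Z i) * sig_mul_self p q i

/-- Conformal null case, description of F(Z): for Z ≠ 0 with ⟨Z,Z⟩ = 0,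
⁅ι₋(X), ⁅ι₋(X), ι₊(Z)⁆⁆ = 0 iff Z⬝X = 0 and ⟨X,X⟩ = 0. -/
theorem conformal_null_FZ (p q : ℕ) (hn : 3 ≤ p + q) (Z : Fin (p + q) → ℝ)
    (hZ : Z ≠ 0) (hnull : form p q Z Z = 0) (X : Fin (p + q) → ℝ) :
    ⁅iotaMinus p q X, ⁅iotaMinus p q X, iotaPlus p q Z⁆⁆ = 0 ↔
      (∑ i, Z i * X i) = 0 ∧ form p q X X = 0 := by
  rw [lie_iotaMinus_lie_iotaMinus_iotaPlus, iotaMinus_eq_zero_iff]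
  constructor
  · intro h
    have hcoord (i : Fin (p + q)) :
        form p q X X * (sig p q i * Z i) - 2 * (∑ j, Z j * X j) * X i = 0 := by
      simpa [iFlip] using congrFun h i
    have hpair : form p q X X * form p q Z Z
        - 2 * (∑ j, Z j * X j) * (∑ j, Z j * X j) = 0 := by
      conv_lhs => enter [1, 2]; rw [form]
      rw [Finset.mul_sum, Finset.mul_sum _ _ (2 * _), ← Finset.sum_sub_distrib]
      exact Finset.sum_eq_zero fun i _ => by linear_combination Z i * hcoord i
    have hdot : ∑ j, Z j * X j = 0 := by
      rw [hnull] at hpair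
      exact mul_self_eq_zero.mp (by linear_combination -hpair / 2)
    refine ⟨hdot, ?_⟩
    obtain ⟨i, hi⟩ := Function.ne_iff.mp hZ
    have hmul : form p q X X * Z i = 0 := by
      have h_i := hcoord i
      rw [hdot] at h_i
      linear_combination sig p q i * h_i - form p q X X * Z i * sig_mul_self p q i
    exact (mul_eq_zero.mp hmul).resolve_right hi
  · rintro ⟨hdot, hform⟩
    simp [hdot, hform]
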